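/- Let S : ℝ ⇒ ℝⁿ be a smooth sweeping process with bounded values satisfying assumption (A1), and let a ∈ 𝒯. Suppose there exists b > a such that the oriented talweg function φ↑ is finite on (a,b) and integrable on (a,b), and set σ(t) = ∫_a^t φ↑(s) ds for t ∈ [a,b]. Then σ is continuous and increasing with σ(a) = 0, and for every catching-up sequence {(tᵢ,xᵢ)}_{i≥0} ⊂ 𝒮 with all tᵢ ∈ (a,b) and every k ≥ 1 one has Σ_{i=0}^{k−1} ‖x_{i+1} − xᵢ‖ ≤ σ(t_k) − σ(t₀). -/

import Mathlib

open Set Metric Filter MeasureTheory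
open scoped ENNReal RealInnerProductSpace Topology Pointwise

section Preliminaries

variable {E : Type*} [NormedAddCommGroup E] [InnerProductSpace ℝ E]

/-- The graph `𝒮 = {(t,x) : x ∈ S t}` of a multivalued map `S : ℝ ⇒ E`. -/
def sgraph (S : ℝ → Set E) : Set (ℝ × E) := {p | p.2 ∈ S p.1}

/-- The effective domain of a multivalued map. -/
def sdom (S : ℝ → Set E) : Set ℝ := {t | (S t).Nonempty}

/-- The euclidean pairing on `ℝ × E`. -/
def pinner (p q : ℝ × E) : ℝ := p.1 * q.1 + ⟪p.2, q.2⟫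

/-- Fréchet normal cone of a set `C ⊆ E` at `x`. -/
def frechetNC (C : Set E) (x : E) : Set E :=
  {v | ∀ ε : ℝ, 0 < ε → ∃ δ : ℝ, 0 < δ ∧
    ∀ y ∈ C, ‖y - x‖ < δ → ⟪v, y - x⟫ ≤ ε * ‖y - x‖}

/-- Limiting (Mordukhovich) normal cone of a set `C ⊆ E` at `x`. -/
def limitingNC (C : Set E) (x : E) : Set E :=
  {v | ∃ xs vs : ℕ → E, (∀ i, xs i ∈ C) ∧ (∀ i, vs i ∈ frechetNC C (xs i)) ∧
    Tendsto xs atTop (𝓝 x) ∧ Tendsto vs atTop (𝓝 v)}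

/-- Fréchet normal cone of a set `C ⊆ ℝ × E` at `z` (w.r.t. the euclidean pairing). -/
def frechetNCP (C : Set (ℝ × E)) (z : ℝ × E) : Set (ℝ × E) :=
  {v | ∀ ε : ℝ, 0 < ε → ∃ δ : ℝ, 0 < δ ∧
    ∀ y ∈ C, ‖y - z‖ < δ → pinner v (y - z) ≤ ε * ‖y - z‖}

/-- Limiting normal cone of a set `C ⊆ ℝ × E` at `z`. -/
def limitingNCP (C : Set (ℝ × E)) (z : ℝ × E) : Set (ℝ × E) :=
  {v | ∃ zs vs : ℕ → ℝ × E, (∀ i, zs i ∈ C) ∧ (∀ i, vs i ∈ frechetNCP C (zs i)) ∧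
    Tendsto zs atTop (𝓝 z) ∧ Tendsto vs atTop (𝓝 v)}

/-- The (limiting) coderivative `D*S(t,x)(u) = {a : (a,-u) ∈ N_𝒮(t,x)}`. -/
def coderiv (S : ℝ → Set E) (t : ℝ) (x : E) (u : E) : Set ℝ :=
  {a | (a, -u) ∈ limitingNCP (sgraph S) (t, x)}

/-- Asymmetric (oriented) modulus `‖D*S(t,x)|⁺ = sup {a⁺ : a ∈ D*S(t,x)(u), ‖u‖ ≤ 1}`
(with `sup ∅ = 0`). -/
noncomputable def asymMod (S : ℝ → Set E) (t : ℝ) (x : E) : ℝ≥0∞ :=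
  ⨆ (u : E) (_ : ‖u‖ ≤ 1) (a : ℝ) (_ : a ∈ coderiv S t x u), ENNReal.ofReal a

/-- Modulus `‖D*S(t,x)‖⁺ = sup {|a| : a ∈ D*S(t,x)(u), ‖u‖ ≤ 1}` (with `sup ∅ = 0`). -/
noncomputable def symMod (S : ℝ → Set E) (t : ℝ) (x : E) : ℝ≥0∞ :=
  ⨆ (u : E) (_ : ‖u‖ ≤ 1) (a : ℝ) (_ : a ∈ coderiv S t x u), ENNReal.ofReal |a|

/-- Oriented talweg function `φ↑(t) = sup_{x ∈ S(t)} ‖D*S(t,x)|⁺`. -/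
noncomputable def orientedTalweg (S : ℝ → Set E) (t : ℝ) : ℝ≥0∞ :=
  ⨆ x ∈ S t, asymMod S t x

/-- Talweg function `φ(t) = sup_{x ∈ S(t)} ‖D*S(t,x)‖⁺`. -/
noncomputable def talweg (S : ℝ → Set E) (t : ℝ) : ℝ≥0∞ :=
  ⨆ x ∈ S t, symMod S t x

/-- `M` is a `C¹`-submanifold of codimension `c` of `ℝ × E`: locally it is the zero set
of a `C¹` submersion into `ℝ^c`. -/
def IsC1SubmanifoldCodim (c : ℕ) (M : Set (ℝ × E)) : Prop :=
  ∀ z ∈ M, ∃ U : Set (ℝ × E), IsOpen U ∧ z ∈ U ∧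
    ∃ f : ℝ × E → EuclideanSpace ℝ (Fin c),
      ContDiffOn ℝ 1 f U ∧ (∀ y ∈ U, Function.Surjective ⇑(fderivWithin ℝ f U y)) ∧
      M ∩ U = {y ∈ U | f y = 0}

/-- Smooth sweeping process: the graph `𝒮` is closed, connected, and either a `C¹`
submanifold of dimension at most `dim E` (i.e. codimension at least one), or a
full-dimensional manifold with boundary whose boundary `∂𝒮` (the topological frontier)
is a `C¹` submanifold of codimension one. -/
def SmoothSweepingProcess (S : ℝ → Set E) : Prop :=
  IsClosed (sgraph S) ∧ IsConnected (sgraph S) ∧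
    ((∃ c : ℕ, 1 ≤ c ∧ IsC1SubmanifoldCodim c (sgraph S)) ∨
      (sgraph S = closure (interior (sgraph S)) ∧
        IsC1SubmanifoldCodim 1 (frontier (sgraph S))))

/-- The map `H_S(t) = ∂𝒮 ∩ ({t} × E)`. -/
def HSmap (S : ℝ → Set E) (t : ℝ) : Set (ℝ × E) :=
  frontier (sgraph S) ∩ {p : ℝ × E | p.1 = t}

/-- Continuity at `t₀` (relative to `I`) of a set-valued map for the Hausdorff–Pompeiu
metric. -/
def HPContinuousAt {X : Type*} [PseudoEMetricSpace X] (F : ℝ → Set X) (I : Set ℝ)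
    (t₀ : ℝ) : Prop :=
  ∀ ε : ℝ, 0 < ε → ∃ δ : ℝ, 0 < δ ∧ ∀ t ∈ I, |t - t₀| < δ →
    EMetric.hausdorffEdist (F t) (F t₀) < ENNReal.ofReal ε

/-- Continuity on `I` of a set-valued map for the Hausdorff–Pompeiu metric. -/
def HPContinuousOn {X : Type*} [PseudoEMetricSpace X] (F : ℝ → Set X) (I : Set ℝ) : Prop :=
  ∀ t₀ ∈ I, HPContinuousAt F I t₀

/-- `γ` is absolutely continuous on `J` (with some integrable a.e. derivative). -/
def AbsContOn (γ : ℝ → E) (J : Set ℝ) : Prop :=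
  ∃ g : ℝ → E, IntegrableOn g J ∧ ∀ s ∈ J, ∀ t ∈ J, γ t - γ s = ∫ u in s..t, g u

/-- `γ` is piecewise absolutely continuous on `I`: its discontinuities are contained in a
closed countable set `D`, and `γ` is absolutely continuous on each connected component of
`I \ D`. -/
def PiecewiseAC (γ : ℝ → E) (I : Set ℝ) : Prop :=
  ∃ D : Set ℝ, IsClosed D ∧ D.Countable ∧
    ∀ t ∈ I \ D, AbsContOn γ (connectedComponentIn (I \ D) t)

/-- `γ` (an absolutely continuous curve, with a.e. derivative `γ'`) is an orbit of the
sweeping process defined by `S` on the interval `I`:  `γ(t) ∈ S(t)` on `I` and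
`-γ̇(t) ∈ N_{S(t)}(γ(t))` for a.e. `t ∈ I`. -/
def ACOrbit (S : ℝ → Set E) (I : Set ℝ) (γ γ' : ℝ → E) : Prop :=
  (∀ t ∈ I, γ t ∈ S t) ∧ IntegrableOn γ' I ∧
    (∀ s ∈ I, ∀ t ∈ I, γ t - γ s = ∫ u in s..t, γ' u) ∧
    (∀ᵐ t ∂(volume.restrict I), -γ' t ∈ limitingNC (S t) (γ t))

/-- `γ` (with a.e. derivative `γ'`) is a piecewise absolutely continuous orbit of the
sweeping process defined by `S` on `I`. -/
def PACOrbit (S : ℝ → Set E) (I : Set ℝ) (γ γ' : ℝ → E) : Prop :=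
  ∃ D : Set ℝ, IsClosed D ∧ D.Countable ∧
    ∀ t ∈ I \ D, ACOrbit S (connectedComponentIn (I \ D) t) γ γ'

/-- Assumption (A1): from every point `(t,x) ∈ 𝒮` with `‖D*S(t,x)|⁺ < ∞` there issues an
orbit of the sweeping process. -/
def AssumptionA1 (S : ℝ → Set E) : Prop :=
  ∀ t : ℝ, ∀ x ∈ S t, asymMod S t x < ⊤ →
    ∃ δ : ℝ, 0 < δ ∧ ∃ γ γ' : ℝ → E, ACOrbit S (Ico t (t + δ)) γ γ' ∧ γ t = x

/-- Assumption (A2) at `tb`: the oriented talweg is finite just to the right of `tb`. -/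
def AssumptionA2At (S : ℝ → Set E) (tb : ℝ) : Prop :=
  ∃ δ : ℝ, 0 < δ ∧ ∀ t ∈ Ioo tb (tb + δ), orientedTalweg S t < ⊤

/-- Assumption (A3) at `tb`: `H_S` is Hausdorff–Pompeiu continuous just to the right
of `tb`. -/
def AssumptionA3At (S : ℝ → Set E) (tb : ℝ) : Prop :=
  ∃ δ : ℝ, 0 < δ ∧ HPContinuousOn (HSmap S) (Ioo tb (tb + δ))

/-- The set `𝒯` of points of the domain at which (A2) and (A3) hold. -/
def goodSet (S : ℝ → Set E) : Set ℝ :=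
  {t | t ∈ sdom S ∧ AssumptionA2At S t ∧ AssumptionA3At S t}

/-- `S` has bounded values. -/
def BoundedValues (S : ℝ → Set E) : Prop := ∀ t, Bornology.IsBounded (S t)

/-- A catching-up sequence `{(tᵢ,xᵢ)}_{i ≥ 0}` for `S`. -/
def CatchingUp (S : ℝ → Set E) (t : ℕ → ℝ) (x : ℕ → E) : Prop :=
  StrictMono t ∧ (∀ i, x i ∈ S (t i)) ∧
    ∀ i, dist (x i) (x (i + 1)) = infDist (x i) (S (t (i + 1)))

/-- A finite catching-up sequence `{(tᵢ,xᵢ)}_{i=0}^k` for `S`. -/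
def FiniteCatchingUp (S : ℝ → Set E) (k : ℕ) (t : ℕ → ℝ) (x : ℕ → E) : Prop :=
  (∀ i < k, t i < t (i + 1)) ∧ (∀ i ≤ k, x i ∈ S (t i)) ∧
    ∀ i < k, dist (x i) (x (i + 1)) = infDist (x i) (S (t (i + 1)))

/-- A piecewise catching-up sequence for `S`: blocks `{(tʲᵢ,Yʲᵢ)}_{i=0}^{k_j}`, each a
catching-up sequence, with `tʲ_{k_j} = tʲ⁺¹₀`. -/
def PiecewiseCatchingUp (S : ℝ → Set E) (k : ℕ → ℕ) (t : ℕ → ℕ → ℝ) (Y : ℕ → ℕ → E) : Prop :=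
  (∀ j, FiniteCatchingUp S (k j) (t j) (Y j)) ∧ ∀ j, t j (k j) = t (j + 1) 0

/-- Outer semicontinuity of `S` at `tb`. -/
def OuterSemicontinuousAt (S : ℝ → Set E) (tb : ℝ) : Prop :=
  ∀ (tk : ℕ → ℝ) (xk : ℕ → E) (x : E), (∀ k, xk k ∈ S (tk k)) →
    Tendsto tk atTop (𝓝 tb) → Tendsto xk atTop (𝓝 x) → x ∈ S tb

/-- Inner semicontinuity of `S` at `tb`. -/
def InnerSemicontinuousAt (S : ℝ → Set E) (tb : ℝ) : Prop :=
  ∀ x ∈ S tb, ∀ tk : ℕ → ℝ, (∀ k, tk k ∈ sdom S) → Tendsto tk atTop (𝓝 tb) →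
    Tendsto (fun k => infDist x (S (tk k))) atTop (𝓝 0)

/-- The oriented calm graphical modulus `calm↑S(t,x)`. -/
noncomputable def calmUp (S : ℝ → Set E) (t : ℝ) (x : E) : ℝ :=
  sInf {κ : ℝ | 0 < κ ∧ ∃ ε : ℝ, 0 < ε ∧ ∃ δ : ℝ, 0 < δ ∧
    ∀ t₁ ∈ Ioo t (t + ε), S t ∩ ball x δ ⊆ S t₁ + ball (0 : E) (κ * (t₁ - t))}

end Preliminaries

section Helpers

variable {E : Type*} [NormedAddCommGroup E] [InnerProductSpace ℝ E]

/-- The graph of the limiting normal cone is the closure of the graph of the Fréchet one. -/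
lemma mem_limitingNCP_iff (C : Set (ℝ × E)) (z v : ℝ × E) :
    v ∈ limitingNCP C z ↔
      (z, v) ∈ closure {p : (ℝ × E) × (ℝ × E) | p.1 ∈ C ∧ p.2 ∈ frechetNCP C p.1} := by
  rw [mem_closure_iff_seq_limit]
  constructor
  · rintro ⟨zs, vs, h1, h2, h3, h4⟩
    exact ⟨fun i => (zs i, vs i), fun i => ⟨h1 i, h2 i⟩, h3.prodMk_nhds h4⟩
  · rintro ⟨p, hp, hlim⟩
    exact ⟨fun i => (p i).1, fun i => (p i).2, fun i => (hp i).1, fun i => (hp i).2,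
      (continuous_fst.tendsto _).comp hlim, (continuous_snd.tendsto _).comp hlim⟩

lemma frechetNCP_smul {C : Set (ℝ × E)} {z v : ℝ × E} (hv : v ∈ frechetNCP C z) {r : ℝ}
    (hr : 0 < r) : r • v ∈ frechetNCP C z := by
  intro ε hε
  obtain ⟨δ, hδ, h⟩ := hv (ε / r) (by positivity)
  refine ⟨δ, hδ, fun y hy hyz => ?_⟩
  have h1 := h y hy hyz
  have h2 : pinner (r • v) (y - z) = r * pinner v (y - z) := by
    simp [pinner, inner_smul_left]; ring
  rw [h2]
  calc r * pinner v (y - z) ≤ r * (ε / r * ‖y - z‖) := by gcongr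
    _ = ε * ‖y - z‖ := by field_simp

lemma limitingNCP_smul {C : Set (ℝ × E)} {z v : ℝ × E} (hv : v ∈ limitingNCP C z) {r : ℝ}
    (hr : 0 < r) : r • v ∈ limitingNCP C z := by
  obtain ⟨zs, vs, h1, h2, h3, h4⟩ := hv
  exact ⟨zs, fun i => r • vs i, h1, fun i => frechetNCP_smul (h2 i) hr, h3, h4.const_smul r⟩

/-- Localized oriented talweg. -/
noncomputable def locTalweg (S : ℝ → Set E) (K : Set (ℝ × E)) (t : ℝ) : ℝ≥0∞ :=
  ⨆ (y : E) (_ : (t, y) ∈ K), asymMod S t y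

lemma le_asymMod {S : ℝ → Set E} {t : ℝ} {x u : E} {a : ℝ} (hu : ‖u‖ ≤ 1)
    (ha : (a, -u) ∈ limitingNCP (sgraph S) (t, x)) : ENNReal.ofReal a ≤ asymMod S t x := by
  unfold asymMod
  exact le_iSup_of_le u (le_iSup_of_le hu (le_iSup_of_le a (le_iSup_of_le ha le_rfl)))

lemma asymMod_le_locTalweg {S : ℝ → Set E} {K : Set (ℝ × E)} {t : ℝ} {y : E}
    (h : (t, y) ∈ K) : asymMod S t y ≤ locTalweg S K t :=
  le_iSup_of_le y (le_iSup_of_le h le_rfl)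

lemma locTalweg_usc [FiniteDimensional ℝ E] (S : ℝ → Set E) {K : Set (ℝ × E)}
    (hK : IsCompact K) : UpperSemicontinuous (locTalweg S K) := by
  have : ProperSpace E := FiniteDimensional.proper_real E
  intro τ c hc
  obtain ⟨d, hd1, hd2⟩ := ENNReal.lt_iff_exists_nnreal_btwn.1 hc
  have hdpos : (0 : ℝ) < d := by
    have : (0 : ℝ≥0∞) < d := lt_of_le_of_lt bot_le hd1
    exact_mod_cast this
  let T : Set ((ℝ × E) × E) := (K ×ˢ closedBall (0 : E) 1) ∩
    {p | (p.1, ((d : ℝ), -p.2)) ∈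
      closure {p : (ℝ × E) × (ℝ × E) | p.1 ∈ sgraph S ∧ p.2 ∈ frechetNCP (sgraph S) p.1}}
  have hT : IsCompact T := by
    refine (hK.prod (isCompact_closedBall _ _)).inter_right ?_
    exact isClosed_closure.preimage (by fun_prop)
  have hP : IsClosed ((fun p : (ℝ × E) × E => p.1.1) '' T) :=
    (hT.image (by fun_prop)).isClosed
  have hτ : τ ∉ ((fun p : (ℝ × E) × E => p.1.1) '' T) := by
    rintro ⟨⟨⟨τ', y⟩, u⟩, ⟨⟨h1, h2⟩, h3⟩, rfl⟩
    have h4 := le_asymMod (S := S) (t := τ') (x := y) (u := u) (a := d)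
      (by simpa using h2) ((mem_limitingNCP_iff _ _ _).2 h3)
    rw [ENNReal.ofReal_coe_nnreal] at h4
    exact absurd hd1 (not_lt.2 (h4.trans (asymMod_le_locTalweg h1)))
  filter_upwards [hP.isOpen_compl.mem_nhds hτ] with s hs
  refine lt_of_le_of_lt ?_ hd2
  unfold locTalweg asymMod
  refine iSup_le fun y => iSup_le fun hy => iSup_le fun u => iSup_le fun hu =>
    iSup_le fun a => iSup_le fun ha => ?_
  by_contra hlt
  rw [not_le] at hlt
  have had : (d : ℝ) < a := by
    rw [← ENNReal.ofReal_coe_nnreal] at hlt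
    exact (ENNReal.ofReal_lt_ofReal_iff_of_nonneg hdpos.le).1 hlt
  have hapos : 0 < a := hdpos.trans had
  apply hs
  refine ⟨((s, y), ((d : ℝ) / a) • u), ⟨⟨hy, ?_⟩, ?_⟩, rfl⟩
  · simp only [mem_closedBall, dist_zero_right, norm_smul, Real.norm_eq_abs]
    rw [abs_of_pos (by positivity)]
    have : (d : ℝ) / a ≤ 1 := (div_le_one hapos).2 had.le
    exact mul_le_one₀ this (norm_nonneg _) hu
  · have h5 := limitingNCP_smul (r := (d : ℝ) / a) ha (by positivity)
    have h6 : ((d : ℝ) / a) • ((a, -u) : ℝ × E) = ((d : ℝ), -(((d : ℝ) / a) • u)) := by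
      ext
      · simp [hapos.ne']
      · simp
    rw [h6] at h5
    exact (mem_limitingNCP_iff _ _ _).1 h5

/-- At a local maximum over `C` of `Ψ(t) - sqrt(‖y-x‖²+η²)`, the gradient is a Fréchet normal. -/
lemma frechet_of_localMax {C : Set (ℝ × E)} {Ψ : ℝ → ℝ} {c τ η : ℝ} {x y : E} (hη : 0 < η)
    (hΨ : HasDerivAt Ψ c τ)
    (hmax : ∀ᶠ z in 𝓝 ((τ, y) : ℝ × E), z ∈ C →
      Ψ z.1 - √(‖z.2 - x‖ ^ 2 + η ^ 2) ≤ Ψ τ - √(‖y - x‖ ^ 2 + η ^ 2)) :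
    (c, -((1 / √(‖y - x‖ ^ 2 + η ^ 2)) • (y - x))) ∈ frechetNCP C (τ, y) := by
  have hpos : 0 < ‖y - x‖ ^ 2 + η ^ 2 := by positivity
  have h1 : HasFDerivAt (fun z : ℝ × E => Ψ z.1) _ (τ, y) :=
    HasFDerivAt.comp (τ, y) (f := Prod.fst) (hΨ.hasFDerivAt) hasFDerivAt_fst
  have h2 : HasFDerivAt (fun z : ℝ × E => √(‖z.2 - x‖ ^ 2 + η ^ 2)) _ (τ, y) :=
    HasFDerivAt.sqrt (((hasFDerivAt_snd (𝕜 := ℝ) (p := ((τ, y) : ℝ × E))).sub_const x).norm_sq.add_const (η ^ 2)) hpos.ne'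
  have h3 := (h1.sub h2).isLittleO
  intro ε hε
  have h4 := (h3.def hε).and hmax
  obtain ⟨δ, hδ, hball⟩ := Metric.eventually_nhds_iff.1 h4
  refine ⟨δ, hδ, fun z hz hzd => ?_⟩
  obtain ⟨h5, h6⟩ := hball (y := z) (by rwa [dist_eq_norm])
  have h7 := h6 hz
  have h8 := (abs_le.1 h5).1
  simp only [Pi.sub_apply] at h8
  have h9 : ∀ L : ℝ, L = pinner (c, -((1 / √(‖y - x‖ ^ 2 + η ^ 2)) • (y - x))) (z - (τ, y)) →
    -(ε * ‖z - (τ, y)‖) ≤ Ψ z.1 - √(‖z.2 - x‖ ^ 2 + η ^ 2) - (Ψ τ - √(‖y - x‖ ^ 2 + η ^ 2)) - L →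
    pinner (c, -((1 / √(‖y - x‖ ^ 2 + η ^ 2)) • (y - x))) (z - (τ, y)) ≤ ε * ‖z - (τ, y)‖ := by
    intro L hL h
    rw [← hL]; linarith
  refine h9 _ ?_ h8
  have hs : √(‖y - x‖ ^ 2 + η ^ 2) ≠ 0 := (Real.sqrt_pos.2 hpos).ne'
  simp [pinner, inner_smul_left]
  field_simp
  rw [inner_sub_left]
  ring

lemma key_step [FiniteDimensional ℝ E] (S : ℝ → Set E) (hcl : IsClosed (sgraph S))
    {t0 t t1 : ℝ} (h0 : t0 < t) (h1 : t < t1)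
    (hfin : ∀ s ∈ Icc t0 t1, orientedTalweg S s < ⊤)
    (hint : ∫⁻ s in Ioo t t1, orientedTalweg S s < ⊤) {x : E} (hx : x ∈ S t)
    {ε : ℝ} (hε : 0 < ε) :
    ∃ y ∈ S t1, ‖y - x‖ ≤ (∫⁻ s in Ioo t t1, orientedTalweg S s).toReal + 2 * ε := by
  have : ProperSpace E := FiniteDimensional.proper_real E
  set I : ℝ := (∫⁻ s in Ioo t t1, orientedTalweg S s).toReal with hI
  have hI0 : 0 ≤ I := ENNReal.toReal_nonneg
  set R : ℝ := I + 3 * ε with hR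
  let K : Set (ℝ × E) := (Icc t0 t1 ×ˢ closedBall x R) ∩ sgraph S
  have hK : IsCompact K := (isCompact_Icc.prod (isCompact_closedBall _ _)).inter_right hcl
  set f := locTalweg S K with hf
  have husc : UpperSemicontinuous f := locTalweg_usc S hK
  have hfle : ∀ s, f s ≤ orientedTalweg S s := by
    intro s
    refine iSup_le fun y => iSup_le fun hy => ?_
    have hyS : y ∈ S s := hy.2
    exact le_iSup₂_of_le (f := fun x _ => asymMod S s x) y hyS le_rfl
  have hftop : ∀ s, f s < ⊤ := by
    intro s
    by_cases hs : s ∈ Icc t0 t1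
    · exact (hfle s).trans_lt (hfin s hs)
    · have : f s = 0 := by
        simp only [hf, locTalweg, ENNReal.iSup_eq_zero]
        intro y hy
        exact absurd hy.1.1 hs
      rw [this]; exact ENNReal.zero_lt_top
  have hcoe : ∀ s, ((f s).toNNReal : ℝ≥0∞) = f s := fun s => ENNReal.coe_toNNReal (hftop s).ne
  obtain ⟨ψ, hψ1, hψ2, hψ3⟩ := exists_lt_lowerSemicontinuous_lintegral_ge
    (volume.restrict (Ioo t t1)) (fun s => (f s).toNNReal) husc.measurable.ennreal_toNNReal
    (ε := ENNReal.ofReal ε) (by simpa using hε)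
  simp only [hcoe] at hψ1 hψ3
  obtain ⟨c, hc⟩ := exists_continuous_forall_mem_convex_of_local_const
    (X := ℝ) (E := ℝ) (t := fun s => {r : ℝ | f s < ENNReal.ofReal r ∧ ENNReal.ofReal r ≤ ψ s})
    (by
      intro s
      refine Set.OrdConnected.convex ⟨?_⟩
      rintro p ⟨hp1, hp2⟩ q ⟨hq1, hq2⟩ r ⟨hr1, hr2⟩
      exact ⟨hp1.trans_le (ENNReal.ofReal_le_ofReal hr1),
        (ENNReal.ofReal_le_ofReal hr2).trans hq2⟩)
    (by
      intro s
      obtain ⟨d, hd1, hd2⟩ := ENNReal.lt_iff_exists_nnreal_btwn.1 (hψ1 s)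
      refine ⟨d, ?_⟩
      filter_upwards [husc s d hd1, hψ2 s d hd2] with r hr1 hr2
      rw [ENNReal.ofReal_coe_nnreal]
      exact ⟨hr1, hr2.le⟩)
  have hcont : Continuous c := c.continuous
  have hcpos : ∀ s, 0 < c s := fun s => ENNReal.ofReal_pos.1 (bot_le.trans_lt (hc s).1)
  have hii : ∀ p q : ℝ, IntervalIntegrable c volume p q := fun p q => hcont.intervalIntegrable p q
  set Ψ : ℝ → ℝ := fun s => ∫ r in t..s, c r with hΨ
  have hΨd : ∀ s, HasDerivAt Ψ (c s) s := fun s => hcont.integral_hasStrictDerivAt t s |>.hasDerivAt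
  have hΨc : Continuous Ψ := continuous_iff_continuousAt.2 fun s => (hΨd s).continuousAt
  have hΨm : StrictMono Ψ := strictMono_of_hasDerivAt_pos hΨd hcpos
  have hΨt : Ψ t = 0 := by simp [hΨ]
  have hΨ1 : Ψ t1 ≤ I + ε := by
    have e1 : ENNReal.ofReal (Ψ t1) = ∫⁻ s in Ioo t t1, ENNReal.ofReal (c s) := by
      rw [hΨ]
      simp only
      rw [intervalIntegral.integral_of_le h1.le, integral_Ioc_eq_integral_Ioo]
      refine ofReal_integral_eq_lintegral_ofReal ?_ (ae_of_all _ fun s => (hcpos s).le)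
      exact ((hii t t1).1).mono_set Ioo_subset_Ioc_self
    have e2 : ENNReal.ofReal (Ψ t1) ≤ ENNReal.ofReal (I + ε) := by
      rw [e1, ENNReal.ofReal_add hI0 hε.le, hI, ENNReal.ofReal_toReal hint.ne]
      calc ∫⁻ s in Ioo t t1, ENNReal.ofReal (c s) ≤ ∫⁻ s in Ioo t t1, ψ s :=
            lintegral_mono fun s => (hc s).2
        _ ≤ _ := hψ3
        _ ≤ _ := by gcongr; exact hfle _
    exact (ENNReal.ofReal_le_ofReal_iff (by positivity)).1 e2
  let F : ℝ × E → ℝ := fun z => Ψ z.1 - √(‖z.2 - x‖ ^ 2 + ε ^ 2)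
  have hFc : Continuous F := by
    have := hΨc.comp (continuous_fst (X := ℝ) (Y := E))
    refine this.sub ?_
    fun_prop
  have htx : (t, x) ∈ K := ⟨⟨⟨h0.le, h1.le⟩, mem_closedBall_self (by positivity)⟩, hx⟩
  obtain ⟨⟨τ, y⟩, hzK, hzmax⟩ := hK.exists_isMaxOn ⟨_, htx⟩ hFc.continuousOn
  have hFtx : F (t, x) = -ε := by
    simp [F, hΨt, Real.sqrt_sq hε.le]
  have hge : -ε ≤ Ψ τ - √(‖y - x‖ ^ 2 + ε ^ 2) := by
    rw [← hFtx]; exact hzmax htx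
  have hsq1 : ε ≤ √(‖y - x‖ ^ 2 + ε ^ 2) := Real.le_sqrt_of_sq_le (by nlinarith [norm_nonneg (y - x)])
  have hsq2 : ‖y - x‖ ≤ √(‖y - x‖ ^ 2 + ε ^ 2) := Real.le_sqrt_of_sq_le (by nlinarith)
  have hτ0 : t0 < τ := by
    by_contra hle
    have : Ψ τ < Ψ t := hΨm ((not_lt.1 hle).trans_lt h0)
    linarith
  have hτ1 : τ ≤ t1 := hzK.1.1.2
  have hΨτ : Ψ τ ≤ Ψ t1 := hΨm.monotone hτ1
  have hyx : ‖y - x‖ ≤ I + 2 * ε := by linarith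
  rcases hτ1.eq_or_lt with heq | hlt
  · subst heq
    exact ⟨y, hzK.2, hyx⟩
  exfalso
  have hmem : Ioo t0 t1 ×ˢ ball x R ∈ 𝓝 ((τ, y) : ℝ × E) := by
    refine (isOpen_Ioo.prod isOpen_ball).mem_nhds ⟨⟨hτ0, hlt⟩, ?_⟩
    rw [mem_ball, dist_eq_norm]; linarith
  have hfr := frechet_of_localMax (C := sgraph S) (x := x) (y := y) hε (hΨd τ) (by
    filter_upwards [hmem] with z hz hzS
    exact hzmax (⟨⟨Ioo_subset_Icc_self hz.1, ball_subset_closedBall hz.2⟩, hzS⟩ : z ∈ K))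
  have hlim : (c τ, -((1 / √(‖y - x‖ ^ 2 + ε ^ 2)) • (y - x))) ∈
      limitingNCP (sgraph S) (τ, y) :=
    ⟨fun _ => (τ, y), fun _ => _, fun _ => hzK.2, fun _ => hfr, tendsto_const_nhds,
      tendsto_const_nhds⟩
  have hle := le_asymMod (by
    rw [norm_smul, Real.norm_eq_abs, abs_of_nonneg (by positivity), one_div_mul_eq_div]
    exact div_le_one_of_le₀ hsq2 (by positivity)) hlim
  exact absurd (hle.trans (asymMod_le_locTalweg hzK)) (not_le.2 (hc τ).1)

lemma infDist_step [FiniteDimensional ℝ E] (S : ℝ → Set E) (hcl : IsClosed (sgraph S))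
    {t0 t t1 : ℝ} (h0 : t0 < t) (h1 : t < t1)
    (hfin : ∀ s ∈ Icc t0 t1, orientedTalweg S s < ⊤)
    (hint : ∫⁻ s in Ioo t t1, orientedTalweg S s < ⊤) {x : E} (hx : x ∈ S t) :
    infDist x (S t1) ≤ (∫⁻ s in Ioo t t1, orientedTalweg S s).toReal := by
  refine le_of_forall_pos_le_add fun ε hε => ?_
  obtain ⟨y, hy, hyx⟩ := key_step S hcl h0 h1 hfin hint hx (half_pos hε)
  have := infDist_le_dist_of_mem (x := x) hy
  rw [dist_comm, dist_eq_norm] at this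
  linarith

/-- Additivity of the (lower) integral on adjacent intervals. -/
lemma sigma_add (φ : ℝ → ℝ≥0∞) {a s t b : ℝ} (has : a ≤ s) (hst : s ≤ t) (htb : t ≤ b)
    (hint : ∫⁻ r in Ioo a b, φ r < ⊤) :
    (∫⁻ r in Ioo a t, φ r).toReal =
      (∫⁻ r in Ioo a s, φ r).toReal + (∫⁻ r in Ioo s t, φ r).toReal := by
  have hle : ∀ A : Set ℝ, A ⊆ Ioo a b → ∫⁻ r in A, φ r ≠ ⊤ := fun A hA =>
    ((lintegral_mono_set hA).trans_lt hint).ne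
  rw [← ENNReal.toReal_add (hle _ (Ioo_subset_Ioo_right (hst.trans htb)))
    (hle _ (Ioo_subset_Ioo has htb))]
  congr 1
  have e1 : ∀ p q : ℝ, ∫⁻ r in Ioo p q, φ r = ∫⁻ r in Ioc p q, φ r := fun p q =>
    setLIntegral_congr Ioo_ae_eq_Ioc
  rw [e1, e1, e1, ← lintegral_union measurableSet_Ioc (Ioc_disjoint_Ioc_of_le le_rfl),
    Ioc_union_Ioc_eq_Ioc has hst]

end Helpers

/-- Theorem B, (a)-(d) ⇒ (e): if the oriented talweg is finite and
integrable on `(a,b)`, then `σ(t) = ∫_a^t φ↑` is continuous and increasing with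
`σ(a) = 0`, and it controls uniformly all catching-up sequences in `(a,b)`. -/
theorem statement4 {E : Type*} [NormedAddCommGroup E] [InnerProductSpace ℝ E]
    [FiniteDimensional ℝ E] (S : ℝ → Set E)
    (hS : SmoothSweepingProcess S) (hbv : BoundedValues S) (hA1 : AssumptionA1 S)
    (a : ℝ) (ha : a ∈ goodSet S) (b : ℝ) (hab : a < b)
    (hfin : ∀ t ∈ Ioo a b, orientedTalweg S t < ⊤)
    (hint : ∫⁻ t in Ioo a b, orientedTalweg S t < ⊤) :
    ContinuousOn (fun t => (∫⁻ s in Ioo a t, orientedTalweg S s).toReal) (Icc a b) ∧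
    MonotoneOn (fun t => (∫⁻ s in Ioo a t, orientedTalweg S s).toReal) (Icc a b) ∧
    (∫⁻ s in Ioo a a, orientedTalweg S s).toReal = 0 ∧
    ∀ (t : ℕ → ℝ) (x : ℕ → E), CatchingUp S t x → (∀ i, t i ∈ Ioo a b) →
      ∀ k : ℕ, 1 ≤ k →
        ∑ i ∈ Finset.range k, ‖x (i + 1) - x i‖ ≤
          (∫⁻ s in Ioo a (t k), orientedTalweg S s).toReal -
            (∫⁻ s in Ioo a (t 0), orientedTalweg S s).toReal := by
  have hcl : IsClosed (sgraph S) := hS.1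
  set φ := orientedTalweg S with hφ
  have hmono : MonotoneOn (fun t => (∫⁻ s in Ioo a t, φ s).toReal) (Icc a b) := by
    intro s hs t ht hst
    have := sigma_add φ hs.1 hst ht.2 hint
    simp only
    rw [this]
    linarith [ENNReal.toReal_nonneg (a := ∫⁻ r in Ioo s t, φ r)]
  refine ⟨?_, hmono, by simp, ?_⟩
  · rw [Metric.continuousOn_iff]
    intro t ht ε hε
    obtain ⟨δ, hδ, hδ2⟩ := exists_pos_setLIntegral_lt_of_measure_lt
      (μ := volume.restrict (Ioo a b)) (f := φ) hint.ne (ε := ENNReal.ofReal ε) (by simpa using hε)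
    obtain ⟨d, hd0, hd1⟩ := ENNReal.lt_iff_exists_nnreal_btwn.1 hδ
    have key : ∀ p q : ℝ, a ≤ p → p ≤ q → q ≤ b → q - p < d →
        |(∫⁻ s in Ioo a q, φ s).toReal - (∫⁻ s in Ioo a p, φ s).toReal| < ε := by
      intro p q hap hpq hqb hlt
      rw [sigma_add φ hap hpq hqb hint, add_sub_cancel_left, abs_of_nonneg ENNReal.toReal_nonneg]
      have h1 := hδ2 (Ioo p q) (by
        refine (Measure.restrict_apply_le _ _).trans_lt ?_
        rw [Real.volume_Ioo]
        refine lt_trans ?_ hd1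
        rw [← ENNReal.ofReal_coe_nnreal]
        exact (ENNReal.ofReal_lt_ofReal_iff_of_nonneg (by linarith)).2 hlt)
      rw [Measure.restrict_restrict measurableSet_Ioo,
        inter_eq_left.2 (Ioo_subset_Ioo hap hqb)] at h1
      exact (ENNReal.lt_ofReal_iff_toReal_lt h1.ne_top).1 h1
    refine ⟨d, by exact_mod_cast hd0, fun s hs hst => ?_⟩
    rw [Real.dist_eq] at hst ⊢
    rw [abs_lt] at hst
    rcases le_total s t with h | h
    · rw [abs_sub_comm]
      exact key s t hs.1 h ht.2 (by linarith)
    · exact key t s ht.1 h hs.2 (by linarith)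
  · intro t x hcu hmem k _
    obtain ⟨hsm, hxS, hproj⟩ := hcu
    have hsub : ∀ p q, a ≤ p → q ≤ b → ∫⁻ s in Ioo p q, φ s < ⊤ := fun p q hp hq =>
      (lintegral_mono_set (Ioo_subset_Ioo hp hq)).trans_lt hint
    have hstep : ∀ i, ‖x (i + 1) - x i‖ ≤ (∫⁻ s in Ioo a (t (i + 1)), φ s).toReal -
        (∫⁻ s in Ioo a (t i), φ s).toReal := by
      intro i
      have hlt : t i < t (i + 1) := hsm (Nat.lt_succ_self i)
      obtain ⟨t0, ht0a, ht0⟩ := exists_between (hmem i).1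
      rw [sigma_add φ (hmem i).1.le hlt.le (hmem (i + 1)).2.le hint, add_sub_cancel_left,
        ← dist_eq_norm, dist_comm, hproj i]
      exact infDist_step S hcl ht0 hlt
        (fun s hs => hfin s ⟨ht0a.trans_le hs.1, hs.2.trans_lt (hmem (i + 1)).2⟩)
        (hsub _ _ (hmem i).1.le (hmem (i + 1)).2.le) (hxS i)
    calc ∑ i ∈ Finset.range k, ‖x (i + 1) - x i‖
        ≤ ∑ i ∈ Finset.range k, ((∫⁻ s in Ioo a (t (i + 1)), φ s).toReal -
          (∫⁻ s in Ioo a (t i), φ s).toReal) := Finset.sum_le_sum fun i _ => hstep i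
      _ = _ := Finset.sum_range_sub (fun i => (∫⁻ s in Ioo a (t i), φ s).toReal) k
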